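/- Let ρ ∈ (-1,1) with |ρ| ≤ ρ_0 = √(3+2√3)/3. For each λ ∈ ℝ let r_0(λ) be the unique root in (-1,1) of h̄_λ'(r) = 0, where h̄_λ(r) = λr - log(1-ρr) + (1/2) log(1-r²), and set L(λ) = h̄_λ(r_0(λ)) + (1/2) log(1-ρ²). Then for every c ∈ (-1,1), sup_{λ ∈ ℝ} { cλ - L(λ) } = log( (1-ρc) / (√(1-ρ²) √(1-c²)) ), and the supremum is attained at λ_c = c/(1-c²) - ρ/(1-ρc), the unique λ with r_0(λ) = c (equivalently L'(λ_c) = c). -/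

import Mathlib

open Real Filter

/-- The phase function `h̄_λ(r) = λr - log(1-ρr) + (1/2) log(1-r²)`. -/
noncomputable def hbar (ρ lam r : ℝ) : ℝ :=
  lam * r - Real.log (1 - ρ * r) + (1 / 2) * Real.log (1 - r ^ 2)

lemma one_sub_mul_pos {a r : ℝ} (ha : a ∈ Set.Ioo (-1 : ℝ) 1) (hr : r ∈ Set.Icc (-1 : ℝ) 1) :
    0 < 1 - a * r := by
  obtain ⟨h₁, h₂⟩ := ha
  obtain ⟨h₃, h₄⟩ := hr
  rcases h₄.lt_or_eq with h | rfl
  · nlinarith [mul_pos (neg_lt_iff_pos_add'.1 h₁) (sub_pos.2 h),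
      mul_nonneg (sub_pos.2 h₂).le (neg_le_iff_add_nonneg'.1 h₃)]
  · linarith

lemma one_sub_sq_pos {r : ℝ} (hr : r ∈ Set.Ioo (-1 : ℝ) 1) : 0 < 1 - r ^ 2 := by
  have := one_sub_mul_pos hr (Set.Ioo_subset_Icc_self hr)
  nlinarith

lemma hasDerivAt_hbar {ρ r : ℝ} (l : ℝ) (hρ : ρ ∈ Set.Ioo (-1 : ℝ) 1)
    (hr : r ∈ Set.Ioo (-1 : ℝ) 1) :
    HasDerivAt (hbar ρ l) (l + ρ / (1 - ρ * r) - r / (1 - r ^ 2)) r := by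
  have h₁ := (one_sub_mul_pos hρ (Set.Ioo_subset_Icc_self hr)).ne'
  have h₂ := (one_sub_sq_pos hr).ne'
  have d₁ := (((hasDerivAt_id r).const_mul ρ).const_sub 1).log h₁
  have d₂ := (((hasDerivAt_id r).pow 2).const_sub 1).log h₂
  refine ((((hasDerivAt_id r).const_mul l).sub d₁).add (d₂.const_mul (1 / 2))).congr_deriv ?_
  simp only [id, Pi.pow_apply]
  field_simp
  ring

lemma exp_hbar {ρ r : ℝ} (l : ℝ) (hρ : ρ ∈ Set.Ioo (-1 : ℝ) 1) (hr : r ∈ Set.Ioo (-1 : ℝ) 1) :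
    Real.exp (hbar ρ l r) = Real.exp (l * r) * Real.sqrt (1 - r ^ 2) / (1 - ρ * r) := by
  have h₁ := one_sub_mul_pos hρ (Set.Ioo_subset_Icc_self hr)
  have h₂ := one_sub_sq_pos hr
  have h₃ : (1 / 2) * Real.log (1 - r ^ 2) = Real.log (Real.sqrt (1 - r ^ 2)) := by
    rw [Real.log_sqrt h₂.le]
    ring
  rw [hbar, h₃, Real.exp_add, Real.exp_sub, Real.exp_log h₁, Real.exp_log (Real.sqrt_pos.2 h₂)]
  ring

/-- The phase function attains its maximum over `(-1, 1)` at a critical point: its exponential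
extends continuously to `[-1, 1]` and vanishes at the end points. -/
lemma exists_hbar_critical_max {ρ : ℝ} (l : ℝ) (hρ : ρ ∈ Set.Ioo (-1 : ℝ) 1) :
    ∃ m ∈ Set.Ioo (-1 : ℝ) 1, l + ρ / (1 - ρ * m) - m / (1 - m ^ 2) = 0 ∧
      ∀ r ∈ Set.Ioo (-1 : ℝ) 1, hbar ρ l r ≤ hbar ρ l m := by
  set g : ℝ → ℝ := fun r => Real.exp (l * r) * Real.sqrt (1 - r ^ 2) / (1 - ρ * r) with hg
  have hcont : ContinuousOn g (Set.Icc (-1) 1) := by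
    refine ContinuousOn.div (by fun_prop) (by fun_prop) fun r hr => ?_
    exact (one_sub_mul_pos hρ hr).ne'
  obtain ⟨m, hm, hmax⟩ :=
    isCompact_Icc.exists_isMaxOn (Set.nonempty_Icc.2 (by norm_num : (-1 : ℝ) ≤ 1)) hcont
  have hpos : 0 < g m := by
    have h0 : g 0 ≤ g m := hmax (by constructor <;> norm_num)
    have : g 0 = 1 := by simp [hg]
    linarith
  have hm₁ : m ≠ -1 := by
    rintro rfl
    simp [hg] at hpos
  have hm₂ : m ≠ 1 := by
    rintro rfl
    simp [hg] at hpos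
  have hmI : m ∈ Set.Ioo (-1 : ℝ) 1 := ⟨lt_of_le_of_ne hm.1 hm₁.symm, lt_of_le_of_ne hm.2 hm₂⟩
  have hle : ∀ r ∈ Set.Ioo (-1 : ℝ) 1, hbar ρ l r ≤ hbar ρ l m := fun r hr => by
    rw [← Real.exp_le_exp, exp_hbar l hρ hr, exp_hbar l hρ hmI]
    exact hmax (Set.Ioo_subset_Icc_self hr)
  have hloc : IsLocalMax (hbar ρ l) m := by
    filter_upwards [isOpen_Ioo.mem_nhds hmI] with r hr using hle r hr
  exact ⟨m, hmI, hloc.hasDerivAt_eq_zero (hasDerivAt_hbar l hρ hmI), hle⟩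

lemma mul_sub_hbar_self {ρ c : ℝ} (l : ℝ) (hρ : ρ ∈ Set.Ioo (-1 : ℝ) 1)
    (hc : c ∈ Set.Ioo (-1 : ℝ) 1) :
    c * l - (hbar ρ l c + (1 / 2) * Real.log (1 - ρ ^ 2)) =
      Real.log ((1 - ρ * c) / (Real.sqrt (1 - ρ ^ 2) * Real.sqrt (1 - c ^ 2))) := by
  have h₁ := one_sub_mul_pos hρ (Set.Ioo_subset_Icc_self hc)
  have h₂ := one_sub_sq_pos hc
  have h₃ := one_sub_sq_pos hρ
  have s₂ := (Real.sqrt_pos.2 h₂).ne'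
  have s₃ := (Real.sqrt_pos.2 h₃).ne'
  rw [Real.log_div h₁.ne' (mul_ne_zero s₃ s₂), Real.log_mul s₃ s₂, Real.log_sqrt h₂.le,
    Real.log_sqrt h₃.le, hbar]
  ring

theorem stmt_11 (ρ : ℝ) (hρ : ρ ∈ Set.Ioo (-1 : ℝ) 1)
    (hρ0 : |ρ| ≤ Real.sqrt (3 + 2 * Real.sqrt 3) / 3)
    (r0 : ℝ → ℝ)
    (hr0 : ∀ l : ℝ, r0 l ∈ Set.Ioo (-1 : ℝ) 1 ∧
      l + ρ / (1 - ρ * r0 l) - r0 l / (1 - r0 l ^ 2) = 0 ∧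
      ∀ r ∈ Set.Ioo (-1 : ℝ) 1, l + ρ / (1 - ρ * r) - r / (1 - r ^ 2) = 0 → r = r0 l)
    (c : ℝ) (hc : c ∈ Set.Ioo (-1 : ℝ) 1) :
    IsLUB
      (Set.range fun l : ℝ => c * l - (hbar ρ l (r0 l) + (1 / 2) * Real.log (1 - ρ ^ 2)))
      (Real.log ((1 - ρ * c) / (Real.sqrt (1 - ρ ^ 2) * Real.sqrt (1 - c ^ 2)))) ∧
    c * (c / (1 - c ^ 2) - ρ / (1 - ρ * c))
        - (hbar ρ (c / (1 - c ^ 2) - ρ / (1 - ρ * c))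
            (r0 (c / (1 - c ^ 2) - ρ / (1 - ρ * c)))
          + (1 / 2) * Real.log (1 - ρ ^ 2))
      = Real.log ((1 - ρ * c) / (Real.sqrt (1 - ρ ^ 2) * Real.sqrt (1 - c ^ 2))) ∧
    r0 (c / (1 - c ^ 2) - ρ / (1 - ρ * c)) = c ∧
    (∀ l : ℝ, r0 l = c → l = c / (1 - c ^ 2) - ρ / (1 - ρ * c)) := by
  have hroot : r0 (c / (1 - c ^ 2) - ρ / (1 - ρ * c)) = c :=
    ((hr0 _).2.2 c hc (by ring)).symm
  have hval : c * (c / (1 - c ^ 2) - ρ / (1 - ρ * c))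
        - (hbar ρ (c / (1 - c ^ 2) - ρ / (1 - ρ * c))
            (r0 (c / (1 - c ^ 2) - ρ / (1 - ρ * c)))
          + (1 / 2) * Real.log (1 - ρ ^ 2))
      = Real.log ((1 - ρ * c) / (Real.sqrt (1 - ρ ^ 2) * Real.sqrt (1 - c ^ 2))) := by
    rw [hroot]
    exact mul_sub_hbar_self _ hρ hc
  refine ⟨IsGreatest.isLUB ⟨⟨_, hval⟩, ?_⟩, hval, hroot, fun l hl => ?_⟩
  · rintro _ ⟨l, rfl⟩
    obtain ⟨m, hm, hcrit, hle⟩ := exists_hbar_critical_max l hρ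
    have hmax := hle c hc
    rw [(hr0 l).2.2 m hm hcrit] at hmax
    rw [← mul_sub_hbar_self l hρ hc]
    linarith
  · have h := (hr0 l).2.1
    rw [hl] at h
    linarith
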